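/- arXiv:2410.04248 — 7 statements merged into one kernel-verified Lean document; each statement's English description precedes it below -/
import Mathlib

section
/- Let E be a real inner product space, let ξ > 0 and η ≥ 0, and let φ : E → ℝ ∪ {∞} be a proper ξ-strongly convex function. If y ∈ E satisfies 0 ∈ ∂_η φ(y), then 0 ∈ ∂_{2η} ( φ(·) − (ξ/4)‖· − y‖² )(y). -/
noncomputable section

open RealInnerProductSpace

variable {E : Type*} [NormedAddCommGroup E] [InnerProductSpace ℝ E]

/-- The ε-subdifferential of an extended-real-valued function:
`∂_ε φ(y) = {u : φ(z) ≥ φ(y) + ⟨u, z − y⟩ − ε for all z}`. -/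
def epsSubdiff (φ : E → EReal) (ε : ℝ) (y : E) : Set E :=
  {u : E | ∀ z : E, φ y + ((⟪u, z - y⟫ - ε : ℝ) : EReal) ≤ φ z}

/-- Convexity of an extended-real-valued function. -/
def ERealConvexOn (φ : E → EReal) : Prop :=
  ∀ x y : E, ∀ a b : ℝ, 0 ≤ a → 0 ≤ b → a + b = 1 →
    φ (a • x + b • y) ≤ (a : EReal) * φ x + (b : EReal) * φ y

/-- `φ` is ξ-strongly convex if `φ − (ξ/2)‖·‖²` is convex. -/
def ERealStrongConvexOn (ξ : ℝ) (φ : E → EReal) : Prop :=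
  ERealConvexOn (fun z => φ z - ((ξ / 2 * ‖z‖ ^ 2 : ℝ) : EReal))

/-- A function `E → ℝ ∪ {∞}` is proper if it is not identically `∞`
(and it never takes the value `−∞`). -/
def ProperFun (φ : E → EReal) : Prop := (∀ z, φ z ≠ ⊥) ∧ ∃ z, φ z ≠ ⊤

/-- If `φ` is proper and ξ-strongly convex and `0 ∈ ∂_η φ(y)`, then
`0 ∈ ∂_{2η}(φ(·) − (ξ/4)‖· − y‖²)(y)`. -/
theorem zero_mem_epsSubdiff_sub_quadratic
    (ξ η : ℝ) (hξ : 0 < ξ) (hη : 0 ≤ η) (φ : E → EReal)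
    (hproper : ProperFun φ) (hsc : ERealStrongConvexOn ξ φ) (y : E)
    (hy : (0 : E) ∈ epsSubdiff φ η y) :
    (0 : E) ∈ epsSubdiff (fun x => φ x - ((ξ / 4 * ‖x - y‖ ^ 2 : ℝ) : EReal)) (2 * η) y := by
  obtain ⟨hbot, z0, hz0⟩ := hproper
  have hmem : ∀ z : E, φ y + ((-η : ℝ) : EReal) ≤ φ z := by
    intro z
    have h := hy z
    simpa only [inner_zero_left, zero_sub] using h
  have hytop : φ y ≠ ⊤ := by
    intro h
    have h1 := hmem z0
    rw [h, EReal.top_add_coe, top_le_iff] at h1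
    exact hz0 h1
  intro z
  simp only [inner_zero_left, zero_sub, sub_self]
  by_cases hz : φ z = ⊤
  · rw [hz, EReal.top_sub_coe]
    exact le_top
  have hc := hsc y z (1/2) (1/2) (by norm_num) (by norm_num) (by norm_num)
  have hm := hmem ((1/2 : ℝ) • y + (1/2 : ℝ) • z)
  have hn : ‖(1/2 : ℝ) • y + (1/2 : ℝ) • z‖ ^ 2
      = 1/2 * ‖y‖ ^ 2 + 1/2 * ‖z‖ ^ 2 - 1/4 * ‖z - y‖ ^ 2 := by
    rw [← smul_add, norm_smul, mul_pow, norm_add_sq_real, norm_sub_sq_real,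
      real_inner_comm z y]
    norm_num
    ring
  dsimp only at hc
  rw [hn] at hc
  generalize (1/2 : ℝ) • y + (1/2 : ℝ) • z = m at hc hm
  have hyb := hbot y
  have hzb := hbot z
  have hmb := hbot m
  generalize φ y = a at *
  generalize φ z = b at *
  generalize φ m = c at *
  lift a to ℝ using ⟨hytop, hyb⟩
  lift b to ℝ using ⟨hz, hzb⟩
  have hct : c ≠ ⊤ := by
    rintro rfl
    rw [EReal.top_sub_coe, top_le_iff] at hc
    norm_cast at hc
    exact EReal.coe_ne_top _ hc
  lift c to ℝ using ⟨hct, hmb⟩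
  norm_cast at hc hm ⊢
  simp only [norm_zero]
  nlinarith
end
end

section
/- Let μ ≥ 0 and let (L_j)_{j≥1} be a nondecreasing sequence of positive reals. Define A_0 = 0, τ_0 = 1, and for j ≥ 1: a_{j−1} = (τ_{j−1} + √(τ_{j−1}² + 4 τ_{j−1} A_{j−1} L_j)) / (2 L_j), A_j = A_{j−1} + a_{j−1}, τ_j = τ_{j−1} + a_{j−1} μ / 2. Then for every j ≥ 1, A_j L_j ≥ j²/4. -/
/-- For the RPF-SFISTA scalar recurrences with a nondecreasing sequence of positive
stepsize estimates `L_j`, one has `A_j L_j ≥ j²/4` for every `j ≥ 1`. -/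
theorem sfista_AjLj_quadratic_growth
    (μ : ℝ) (hμ : 0 ≤ μ) (L A τ a : ℕ → ℝ)
    (hL : ∀ j : ℕ, 1 ≤ j → 0 < L j)
    (hmono : ∀ j : ℕ, 1 ≤ j → L j ≤ L (j + 1))
    (hA0 : A 0 = 0) (hτ0 : τ 0 = 1)
    (ha : ∀ j : ℕ, 1 ≤ j →
      a (j - 1) = (τ (j - 1) + Real.sqrt ((τ (j - 1)) ^ 2 + 4 * τ (j - 1) * A (j - 1) * L j)) /
        (2 * L j))
    (hA : ∀ j : ℕ, 1 ≤ j → A j = A (j - 1) + a (j - 1))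
    (hτ : ∀ j : ℕ, 1 ≤ j → τ j = τ (j - 1) + a (j - 1) * μ / 2) :
    ∀ j : ℕ, 1 ≤ j → (j : ℝ) ^ 2 / 4 ≤ A j * L j := by

  have step : ∀ j : ℕ, 1 ≤ τ j → 0 ≤ A j → (j : ℝ) ^ 2 / 4 ≤ A j * L (j + 1) →
      0 ≤ a j ∧ ((j : ℝ) + 1) ^ 2 / 4 ≤ A (j + 1) * L (j + 1) := by
    intro j h1 h2 h3
    have hLp := hL (j + 1) (by omega)
    have e1 := ha (j + 1) (by omega)
    have e2 := hA (j + 1) (by omega)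
    simp only [Nat.add_sub_cancel] at e1 e2
    have hs : (j : ℝ) ≤ Real.sqrt ((τ j) ^ 2 + 4 * τ j * A j * L (j + 1)) := by
      apply Real.le_sqrt_of_sq_le
      have h0 : 0 ≤ A j * L (j + 1) := by positivity
      nlinarith [mul_nonneg (sub_nonneg.2 h1) h0, sq_nonneg (τ j)]
    have hj : (0 : ℝ) ≤ j := Nat.cast_nonneg j
    have e3 : a j * L (j + 1) =
        (τ j + Real.sqrt ((τ j) ^ 2 + 4 * τ j * A j * L (j + 1))) / 2 := by
      rw [e1]; field_simp
    refine ⟨?_, ?_⟩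
    · rw [e1]; positivity
    · rw [e2, add_mul, e3]; nlinarith
  have inv : ∀ j : ℕ, 1 ≤ τ j ∧ 0 ≤ A j ∧ (j : ℝ) ^ 2 / 4 ≤ A j * L (j + 1) := by
    intro j
    induction j with
    | zero => simp [hA0, hτ0]
    | succ k ih =>
      obtain ⟨h1, h2, h3⟩ := ih
      obtain ⟨s1, s2⟩ := step k h1 h2 h3
      have e2 := hA (k + 1) (by omega)
      have e3 := hτ (k + 1) (by omega)
      simp only [Nat.add_sub_cancel] at e2 e3
      have hA1 : 0 ≤ A (k + 1) := by rw [e2]; positivity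
      refine ⟨?_, hA1, ?_⟩
      · rw [e3]
        have : 0 ≤ a k * μ / 2 := by positivity
        linarith
      · push_cast
        exact s2.trans (mul_le_mul_of_nonneg_left (hmono (k + 1) (by omega)) hA1)
  intro j hj
  obtain ⟨k, rfl⟩ := Nat.exists_eq_add_of_le' hj
  obtain ⟨h1, h2, h3⟩ := inv k
  push_cast
  exact (step k h1 h2 h3).2
end

section
/- Let μ > 0 and M > 0, and let (L_j)_{j≥1} be a nondecreasing sequence of positive reals with L_j ≤ M for all j. Define A_0 = 0, τ_0 = 1, and for j ≥ 1: a_{j−1} = (τ_{j−1} + √(τ_{j−1}² + 4 τ_{j−1} A_{j−1} L_j)) / (2 L_j), A_j = A_{j−1} + a_{j−1}, τ_j = τ_{j−1} + a_{j−1} μ / 2. Set Q = 2√2 · √(M/μ). Then for every j ≥ 1, A_j L_j ≥ (1 + Q^{−1})^{2(j−1)}. -/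
/-- For the RPF-SFISTA scalar recurrences with a nondecreasing sequence of positive stepsize
estimates `L_j` bounded above by `M`, and `Q = 2√2·√(M/μ)`, one has
`A_j L_j ≥ (1 + Q⁻¹)^(2(j−1))` for every `j ≥ 1`. -/
theorem sfista_AjLj_exponential_growth
    (μ M : ℝ) (hμ : 0 < μ) (hM : 0 < M) (L A τ a : ℕ → ℝ)
    (hL : ∀ j : ℕ, 1 ≤ j → 0 < L j)
    (hmono : ∀ j : ℕ, 1 ≤ j → L j ≤ L (j + 1))
    (hLM : ∀ j : ℕ, 1 ≤ j → L j ≤ M)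
    (hA0 : A 0 = 0) (hτ0 : τ 0 = 1)
    (ha : ∀ j : ℕ, 1 ≤ j →
      a (j - 1) = (τ (j - 1) + Real.sqrt ((τ (j - 1)) ^ 2 + 4 * τ (j - 1) * A (j - 1) * L j)) /
        (2 * L j))
    (hA : ∀ j : ℕ, 1 ≤ j → A j = A (j - 1) + a (j - 1))
    (hτ : ∀ j : ℕ, 1 ≤ j → τ j = τ (j - 1) + a (j - 1) * μ / 2)
    (Q : ℝ) (hQ : Q = 2 * Real.sqrt 2 * Real.sqrt (M / μ)) :
    ∀ j : ℕ, 1 ≤ j → (1 + Q⁻¹) ^ (2 * (j - 1)) ≤ A j * L j := by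
  have hMμ : 0 < M / μ := div_pos hM hμ
  have hQpos : 0 < Q := by rw [hQ]; positivity
  have hQ2 : Q ^ 2 = 8 * (M / μ) := by
    rw [hQ, mul_pow, mul_pow, Real.sq_sqrt hMμ.le, Real.sq_sqrt (by norm_num)]
    ring
  obtain ⟨q, hq⟩ : ∃ q, q = Q⁻¹ := ⟨_, rfl⟩
  have hqpos : 0 < q := by rw [hq]; positivity
  have hq2 : 8 * q ^ 2 * M = μ := by
    rw [hq, inv_pow, hQ2]
    field_simp
  rw [← hq]
  have ha' : ∀ n : ℕ, a n = (τ n + Real.sqrt ((τ n) ^ 2 + 4 * τ n * A n * L (n + 1))) /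
        (2 * L (n + 1)) := fun n => by simpa using ha (n + 1) (by omega)
  have hA' : ∀ n : ℕ, A (n + 1) = A n + a n := fun n => by simpa using hA (n + 1) (by omega)
  have hτ' : ∀ n : ℕ, τ (n + 1) = τ n + a n * μ / 2 := fun n => by
    simpa using hτ (n + 1) (by omega)
  have hτA : ∀ n : ℕ, τ n = 1 + A n * μ / 2 := by
    intro n
    induction n with
    | zero => simp [hA0, hτ0]
    | succ n ih => rw [hτ', hA', ih]; ring
  have hAnn : ∀ n : ℕ, 0 ≤ A n := by
    intro n
    induction n with
    | zero => simp [hA0]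
    | succ n ih =>
      have hLp := hL (n + 1) (by omega)
      have hτn : 0 < τ n := by rw [hτA]; positivity
      have : 0 ≤ a n := by rw [ha']; positivity
      rw [hA']; linarith
  have step : ∀ n : ℕ, (1 + q) ^ 2 * A n ≤ A (n + 1) := by
    intro n
    have hLp := hL (n + 1) (by omega)
    have hLm := hLM (n + 1) (by omega)
    have hAn := hAnn n
    have h1 : 4 * q ^ 2 * L (n + 1) * A n ≤ τ n := by
      have : 4 * q ^ 2 * L (n + 1) * A n ≤ 4 * q ^ 2 * M * A n := by gcongr
      rw [hτA, ← hq2]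
      linarith
    have h2 : 4 * q * A n * L (n + 1) ≤
        Real.sqrt ((τ n) ^ 2 + 4 * τ n * A n * L (n + 1)) := by
      apply Real.le_sqrt_of_sq_le
      have := mul_le_mul_of_nonneg_right h1 (by positivity : 0 ≤ 4 * A n * L (n + 1))
      nlinarith [sq_nonneg (τ n)]
    have h3 : (2 * q ^ 2 + 2 * q) * A n ≤ a n := by
      rw [ha', le_div_iff₀ (by positivity)]
      linarith
    rw [hA']
    nlinarith [mul_nonneg (sq_nonneg q) hAn]
  have main : ∀ n : ℕ, (1 + q) ^ (2 * n) ≤ A (n + 1) * L (n + 1) := by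
    intro n
    induction n with
    | zero =>
      have hLp := hL 1 le_rfl
      have h : A 1 = 1 / L 1 := by
        have h0 := hA' 0
        rw [ha' 0, hA0, hτ0] at h0
        norm_num at h0
        rw [h0]; field_simp
      simp only [zero_add, mul_zero, pow_zero, h]
      rw [one_div, inv_mul_cancel₀ hLp.ne']
    | succ n ih =>
      have hLp := hL (n + 1) (by omega)
      calc (1 + q) ^ (2 * (n + 1)) = (1 + q) ^ 2 * (1 + q) ^ (2 * n) := by ring
        _ ≤ (1 + q) ^ 2 * (A (n + 1) * L (n + 1)) := by gcongr
        _ = ((1 + q) ^ 2 * A (n + 1)) * L (n + 1) := by ring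
        _ ≤ A (n + 1 + 1) * L (n + 1 + 1) :=
          mul_le_mul (step _) (hmono _ (by omega)) hLp.le (hAnn _)
  intro j hj
  obtain ⟨n, rfl⟩ : ∃ n, j = n + 1 := ⟨j - 1, by omega⟩
  simpa using main n
end

section
/- Let E be a real inner product space, f : E → ℝ a differentiable convex function whose gradient is L̄-Lipschitz, and h : E → ℝ ∪ {∞} a proper closed convex function. Let L > 0, x̃ ∈ E, and let y be the minimizer over E of u ↦ ℓ_f(u; x̃) + h(u) + (L/2)‖u − x̃‖². Define s = L(x̃ − y) and v = ∇f(y) − ∇f(x̃) + s. Then v ∈ ∇f(y) + ∂h(y) and ‖v‖ ≤ (L̄ + L)‖y − x̃‖. -/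
noncomputable section

open RealInnerProductSpace

variable {E : Type*} [NormedAddCommGroup E] [InnerProductSpace ℝ E]

/-- If `y` minimizes `u ↦ ℓ_f(u; xt) + h(u) + (L/2)‖u − xt‖²`, `s = L(xt − y)` and
`v = ∇f(y) − ∇f(xt) + s`, then `v ∈ ∇f(y) + ∂h(y)` and `‖v‖ ≤ (L̄ + L)‖y − xt‖`. -/
theorem prox_step_residual
    (f : E → ℝ) (f' : E → E) (hf : ∀ x : E, HasFDerivAt f ((innerSL ℝ) (f' x)) x)
    (hconv : ConvexOn ℝ Set.univ f) (Lbar : ℝ) (hLbar : 0 ≤ Lbar)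
    (hlip : ∀ z z' : E, ‖f' z' - f' z‖ ≤ Lbar * ‖z' - z‖)
    (h : E → EReal) (hproper : ProperFun h) (hclosed : LowerSemicontinuous h)
    (hconvh : ERealConvexOn h)
    (L : ℝ) (hL : 0 < L) (xt y : E)
    (hy : ∀ u : E,
      ((f xt + ⟪f' xt, y - xt⟫ + L / 2 * ‖y - xt‖ ^ 2 : ℝ) : EReal) + h y ≤
      ((f xt + ⟪f' xt, u - xt⟫ + L / 2 * ‖u - xt‖ ^ 2 : ℝ) : EReal) + h u)
    (s v : E) (hs : s = L • (xt - y)) (hv : v = f' y - f' xt + s) :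
    v - f' y ∈ epsSubdiff h 0 y ∧ ‖v‖ ≤ (Lbar + L) * ‖y - xt‖ := by
  obtain ⟨hbot, z0, hz0⟩ := hproper
  have hytop : h y ≠ ⊤ := by
    intro htop
    have h1 := hy z0
    obtain ⟨c, hc⟩ : ∃ c : ℝ, h z0 = c := ⟨(h z0).toReal, (EReal.coe_toReal hz0 (hbot z0)).symm⟩
    rw [htop, hc, EReal.coe_add_top, ← EReal.coe_add] at h1
    exact EReal.coe_ne_top _ (top_le_iff.mp h1)
  obtain ⟨a, ha⟩ : ∃ c : ℝ, h y = c := ⟨(h y).toReal, (EReal.coe_toReal hytop (hbot y)).symm⟩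
  have hvs : v - f' y = L • (xt - y) - f' xt := by rw [hv, hs]; abel
  constructor
  · intro z
    by_cases hz : h z = ⊤
    · rw [hz]; exact le_top
    obtain ⟨b, hb⟩ : ∃ c : ℝ, h z = c := ⟨(h z).toReal, (EReal.coe_toReal hz (hbot z)).symm⟩
    rw [hvs, ha, hb, ← EReal.coe_add, EReal.coe_le_coe_iff, inner_sub_left, real_inner_smul_left,
      ← neg_sub y xt, inner_neg_left]
    have key : ∀ t : ℝ, 0 < t → t ≤ 1 →
        0 ≤ (⟪f' xt, z - y⟫ + L * ⟪y - xt, z - y⟫ + b - a) + t * (L / 2 * ‖z - y‖ ^ 2) := by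
      intro t ht ht1
      have h1 := hconvh y z (1 - t) t (by linarith) ht.le (by ring)
      have h2 := hy ((1 - t) • y + t • z)
      have h3 := h2.trans (add_le_add_right h1 _)
      have hu : (1 - t) • y + t • z - xt = (y - xt) + t • (z - y) := by module
      rw [ha, hb, hu, ← EReal.coe_mul, ← EReal.coe_mul, ← EReal.coe_add, ← EReal.coe_add,
        ← EReal.coe_add, EReal.coe_le_coe_iff, norm_add_sq_real, inner_add_right,
        real_inner_smul_right, real_inner_smul_right, norm_smul, mul_pow, Real.norm_eq_abs,
        sq_abs] at h3
      refine le_of_mul_le_mul_left ?_ ht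
      linarith
    have hK : 0 ≤ L / 2 * ‖z - y‖ ^ 2 := by positivity
    generalize L / 2 * ‖z - y‖ ^ 2 = K at key hK
    by_contra hcon
    obtain ⟨A, hA⟩ : ∃ A, A = ⟪f' xt, z - y⟫ + L * ⟪y - xt, z - y⟫ + b - a := ⟨_, rfl⟩
    rw [← hA] at key
    have hneg : A < 0 := by linarith
    have hp : 0 < K - A := by linarith
    have h4 := key (-A / (K - A)) (div_pos (by linarith) hp) ((div_le_one hp).2 (by linarith))
    have h5 : A + -A / (K - A) * K = -(A ^ 2) / (K - A) := by field_simp; ring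
    rw [h5] at h4
    have h6 : -(A ^ 2) / (K - A) < 0 := div_neg_of_neg_of_pos (by nlinarith) hp
    linarith
  · rw [hv, hs]
    calc ‖f' y - f' xt + L • (xt - y)‖ ≤ ‖f' y - f' xt‖ + ‖L • (xt - y)‖ := norm_add_le _ _
      _ ≤ Lbar * ‖y - xt‖ + L * ‖y - xt‖ := by
        rw [norm_smul, Real.norm_of_nonneg hL.le, norm_sub_rev xt y]
        linarith [hlip xt y]
      _ = (Lbar + L) * ‖y - xt‖ := by ring
end
end

section
/- Let E be a real inner product space, f : E → ℝ a differentiable convex function, h : E → ℝ ∪ {∞} a proper closed convex function, φ = f + h, μ ≥ 0, χ ∈ (0,1), and L > 0. Let A ≥ 0, τ = 1 + μA/2, and x_prev, y_prev ∈ E. Set a = (τ + √(τ² + 4τAL))/(2L), x̃ = (A·y_prev + a·x_prev)/(A + a), let y be the minimizer over E of u ↦ ℓ_f(u; x̃) + h(u) + (L/2)‖u − x̃‖², and assume the line-search condition ℓ_f(y; x̃) + ((1−χ)L/4)‖y − x̃‖² ≥ f(y) holds. Set s = L(x̃ − y), A⁺ = A + a, τ⁺ = τ + aμ/2, x⁺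 = (1/τ⁺)[(μa/2)y + τ·x_prev − a·s], and γ(x) = φ(y) + 2[ℓ_f(y; x̃) − f(y)] + ⟨s, x − y⟩ + (μ/4)‖x − y‖². Then for every x ∈ E: A·γ(y_prev) + a·γ(x) + (τ/2)‖x_prev − x‖² − (τ⁺/2)‖x⁺ − x‖² ≥ A⁺·φ(y) + (χ A⁺ L / 2)‖y − x̃‖². -/
noncomputable section

open RealInnerProductSpace

variable {E : Type*} [NormedAddCommGroup E] [InnerProductSpace ℝ E]

/-- Lemma A.3 (one-step potential inequality): for one full iteration of RPF-SFISTA,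
`A γ(y_prev) + a γ(x) + (τ/2)‖x_prev − x‖² − (τ⁺/2)‖x⁺ − x‖² ≥ A⁺ φ(y) + (χA⁺L/2)‖y − xt‖²`
for every `x`. -/
theorem sfista_one_step_inequality
    (f : E → ℝ) (f' : E → E) (hf : ∀ x : E, HasFDerivAt f ((innerSL ℝ) (f' x)) x)
    (hfconv : ConvexOn ℝ Set.univ f)
    (h : E → EReal) (hproper : ProperFun h) (hclosed : LowerSemicontinuous h)
    (hconvh : ERealConvexOn h)
    (μ χ L : ℝ) (hμ : 0 ≤ μ) (hχ : 0 < χ ∧ χ < 1) (hL : 0 < L)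
    (A τ : ℝ) (hA : 0 ≤ A) (hτ : τ = 1 + μ * A / 2)
    (xprev yprev : E)
    (a : ℝ) (ha : a = (τ + Real.sqrt (τ ^ 2 + 4 * τ * A * L)) / (2 * L))
    (xt : E) (hxt : xt = (A + a)⁻¹ • (A • yprev + a • xprev))
    (y : E)
    (hy : ∀ u : E,
      ((f xt + ⟪f' xt, y - xt⟫ + L / 2 * ‖y - xt‖ ^ 2 : ℝ) : EReal) + h y ≤
      ((f xt + ⟪f' xt, u - xt⟫ + L / 2 * ‖u - xt‖ ^ 2 : ℝ) : EReal) + h u)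
    (hls : f y ≤ f xt + ⟪f' xt, y - xt⟫ + (1 - χ) * L / 4 * ‖y - xt‖ ^ 2)
    (s : E) (hs : s = L • (xt - y))
    (Aplus τplus : ℝ) (hAplus : Aplus = A + a) (hτplus : τplus = τ + a * μ / 2)
    (xplus : E) (hxplus : xplus = τplus⁻¹ • ((μ * a / 2) • y + τ • xprev - a • s))
    (γ : E → EReal)
    (hγ : ∀ x : E, γ x = ((f y : ℝ) : EReal) + h y +
      ((2 * ((f xt + ⟪f' xt, y - xt⟫) - f y) + ⟪s, x - y⟫ + μ / 4 * ‖x - y‖ ^ 2 : ℝ) : EReal)) :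
    ∀ x : E,
      (Aplus : EReal) * (((f y : ℝ) : EReal) + h y) +
          ((χ * Aplus * L / 2 * ‖y - xt‖ ^ 2 : ℝ) : EReal) ≤
        (A : EReal) * γ yprev + (a : EReal) * γ x +
          ((τ / 2 * ‖xprev - x‖ ^ 2 : ℝ) : EReal) - ((τplus / 2 * ‖xplus - x‖ ^ 2 : ℝ) : EReal) := by
  intro x
  have hτ1 : 1 ≤ τ := by rw [hτ]; have := mul_nonneg hμ hA; linarith
  have hτ0 : 0 < τ := by linarith
  have hτAL : 0 ≤ 4 * τ * A * L := by positivity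
  have hsq := Real.sq_sqrt (show 0 ≤ τ ^ 2 + 4 * τ * A * L by positivity)
  have ha2 : 2 * L * a = τ + Real.sqrt (τ ^ 2 + 4 * τ * A * L) := by
    rw [ha]; field_simp
  have ha0 : 0 < a := by rw [ha]; positivity
  have hquad : L * a ^ 2 = τ * (A + a) := by
    have h1 : Real.sqrt (τ ^ 2 + 4 * τ * A * L) = 2 * L * a - τ := by linarith
    rw [h1] at hsq
    have h2 : 4 * L * (L * a ^ 2) = 4 * L * (τ * (A + a)) := by linarith
    exact mul_left_cancel₀ (by positivity) h2
  have hAa : 0 < A + a := by linarith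
  have haμ : 0 ≤ a * μ := by positivity
  have hτp : 0 < τplus := by rw [hτplus]; linarith
  obtain ⟨H, hH⟩ : ∃ H : ℝ, h y = (H : EReal) := by
    obtain ⟨hb, z, hz⟩ := hproper
    have hyt : h y ≠ ⊤ := by
      intro ht
      have := hy z
      rw [ht, EReal.coe_add_top, top_le_iff] at this
      lift h z to ℝ using ⟨hz, hb z⟩ with w
      exact EReal.coe_ne_top _ (by exact_mod_cast this)
    exact ⟨(h y).toReal, (EReal.coe_toReal hyt (hb y)).symm⟩
  -- vectors relative to `y`
  obtain ⟨p, hp⟩ : ∃ p, p = xprev - y := ⟨_, rfl⟩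
  obtain ⟨q, hq⟩ : ∃ q, q = x - y := ⟨_, rfl⟩
  obtain ⟨v, hv⟩ : ∃ v, v = xt - y := ⟨_, rfl⟩
  obtain ⟨w, hw⟩ : ∃ w, w = xplus - y := ⟨_, rfl⟩
  have e1 : xprev - x = p - q := by rw [hp, hq]; abel
  have e2 : xplus - x = w - q := by rw [hw, hq]; abel
  have e3 : ‖y - xt‖ = ‖v‖ := by rw [hv, norm_sub_rev]
  have hs' : s = L • v := by rw [hs, hv]
  have hwv : τplus • w = τ • p - (a * L) • v := by
    have h1 : τplus • xplus = (μ * a / 2) • y + τ • xprev - a • s := by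
      rw [hxplus, smul_inv_smul₀ hτp.ne']
    rw [hw, smul_sub, h1, hs', hp, hτplus]
    module
  have hyv : A • (yprev - y) = (A + a) • v - a • p := by
    have h1 : (A + a) • xt = A • yprev + a • xprev := by
      rw [hxt, smul_inv_smul₀ hAa.ne']
    rw [hv, smul_sub (A + a), h1, hp]
    module
  have i1 : A * ⟪s, yprev - y⟫ = L * ((A + a) * ‖v‖ ^ 2 - a * ⟪v, p⟫) := by
    have h1 := congrArg (fun z => ⟪v, z⟫) hyv
    simp only [inner_sub_right, real_inner_smul_right, real_inner_self_eq_norm_sq] at h1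
    rw [hs', real_inner_smul_left, ← h1, inner_sub_right]; ring
  have i2 : τplus * ⟪w, q⟫ = τ * ⟪p, q⟫ - a * L * ⟪v, q⟫ := by
    have h1 := congrArg (fun z => ⟪z, q⟫) hwv
    simpa only [inner_sub_left, real_inner_smul_left] using h1
  have i3 : τplus ^ 2 * ‖w‖ ^ 2 = τ ^ 2 * ‖p‖ ^ 2 - 2 * τ * (a * L) * ⟪v, p⟫
      + (a * L) ^ 2 * ‖v‖ ^ 2 := by
    have h1 := congrArg (fun z => ‖z‖ ^ 2) hwv
    simp only [norm_sub_sq_real, norm_smul, mul_pow, Real.norm_eq_abs, sq_abs,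
      real_inner_smul_left, real_inner_smul_right, real_inner_comm v p] at h1
    linarith [real_inner_comm v p]
  have i4 : τplus * ‖w‖ ^ 2 ≤ τ * ‖p‖ ^ 2 - 2 * (a * L) * ⟪v, p⟫ + (A + a) * L * ‖v‖ ^ 2 := by
    refine le_of_mul_le_mul_left ?_ hτ0
    have h1 : τ * (τplus * ‖w‖ ^ 2) ≤ τplus ^ 2 * ‖w‖ ^ 2 := by
      have : 0 ≤ (τplus - τ) * (τplus * ‖w‖ ^ 2) := by
        apply mul_nonneg
        · rw [hτplus]; linarith
        · positivity
      linarith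
    have h2 : (a * L) ^ 2 * ‖v‖ ^ 2 = τ * (A + a) * L * ‖v‖ ^ 2 := by
      rw [← hquad]; ring
    linarith
  have hls' := mul_le_mul_of_nonneg_left hls hAa.le
  have i5 : 0 ≤ A * (μ / 4 * ‖yprev - y‖ ^ 2) := by positivity
  have i6 : ⟪s, x - y⟫ = L * ⟪v, q⟫ := by rw [hs', real_inner_smul_left, hq]
  have i7 : τplus * ‖q‖ ^ 2 = τ * ‖q‖ ^ 2 + a * μ / 2 * ‖q‖ ^ 2 := by rw [hτplus]; ring
  rw [hγ, hγ, hH]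
  norm_cast
  rw [i6, e1, e2, ← hq, hAplus, norm_sub_sq_real p q, norm_sub_sq_real w q]
  rw [e3] at hls' ⊢
  linarith
end
end

section
/- Let E be a real inner product space, φ : E → ℝ ∪ {∞}, χ ∈ (0,1), j ≥ 2 an integer, and let sequences (A_i)_{i=0}^{j−1} of nonnegative reals with A_0 = 0, (τ_i)_{i=0}^{j−1} with τ_0 = 1, (L_i)_{i=1}^{j−1} of positive reals, points (x_i)_{i=0}^{j−1}, (y_i)_{i=1}^{j−1}, (x̃_i)_{i=0}^{j−2} in E, and a point ξ ∈ E be given. Define σ_i(x) = A_i[φ(y_i) − φ(x)] + (τ_i/2)‖x − x_i‖² for 1 ≤ i ≤ j−1, and σ_0(x) = (1/2)‖x − x_0‖². Assume that for each i = 1,…,j−1 and all x with φ(x) finite, σ_{i−1}(x) − σ_i(x) ≥ (χ A_i L_i / 2)‖y_i − x̃_{i−1}‖², and assume φ(ξ) ≤ φ(y_{j−1}). Then for every x with φ(x) finite: A_{j−1}[φ(ξ) − φ(x)] + (τ_{j−1}/2)‖x − x_{j−1}‖² ≤ (1/2)‖x − x_0‖² − (χ/2) Σ_{i=1}^{j−1}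 A_i L_i ‖y_i − x̃_{i−1}‖². -/
noncomputable section

variable {E : Type*} [NormedAddCommGroup E] [InnerProductSpace ℝ E]

/-- Lemma A.7 (telescoped potential decrease): with `A 0 = 0`, `τ 0 = 1`,
`σ_0(x) = (1/2)‖x − x_0‖²` and `σ_i(x) = A_i[φ(y_i) − φ(x)] + (τ_i/2)‖x − x_i‖²`
for `1 ≤ i ≤ j−1`, if each step decreases the potential by `(χ A_i L_i/2)‖y_i − xt_{i−1}‖²`
and `φ(ξ) ≤ φ(y_{j−1})`, then for every `x` with `φ(x)` finite:
`A_{j−1}[φ(ξ) − φ(x)] + (τ_{j−1}/2)‖x − x_{j−1}‖²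
  ≤ (1/2)‖x − x_0‖² − (χ/2)∑_{i=1}^{j−1} A_i L_i ‖y_i − xt_{i−1}‖²`. -/
theorem sfista_telescoped_potential
    (φ : E → EReal) (hbot : ∀ z : E, φ z ≠ ⊥)
    (χ : ℝ) (hχ : 0 < χ ∧ χ < 1)
    (j : ℕ) (hj : 2 ≤ j)
    (A τ L : ℕ → ℝ) (hAnonneg : ∀ i : ℕ, i ≤ j - 1 → 0 ≤ A i)
    (hA0 : A 0 = 0) (hτ0 : τ 0 = 1)
    (hL : ∀ i : ℕ, 1 ≤ i → i ≤ j - 1 → 0 < L i)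
    (x y xt : ℕ → E) (ξ : E)
    (σ : ℕ → E → EReal)
    (hσ0 : ∀ z : E, σ 0 z = ((1 / 2 * ‖z - x 0‖ ^ 2 : ℝ) : EReal))
    (hσ : ∀ i : ℕ, 1 ≤ i → i ≤ j - 1 → ∀ z : E,
      σ i z = (A i : EReal) * (φ (y i) - φ z) + ((τ i / 2 * ‖z - x i‖ ^ 2 : ℝ) : EReal))
    (hdec : ∀ i : ℕ, 1 ≤ i → i ≤ j - 1 → ∀ z : E, φ z ≠ ⊤ →
      ((χ * A i * L i / 2 * ‖y i - xt (i - 1)‖ ^ 2 : ℝ) : EReal) ≤ σ (i - 1) z - σ i z)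
    (hξ : φ ξ ≤ φ (y (j - 1))) :
    ∀ z : E, φ z ≠ ⊤ →
      (A (j - 1) : EReal) * (φ ξ - φ z) + ((τ (j - 1) / 2 * ‖z - x (j - 1)‖ ^ 2 : ℝ) : EReal) ≤
        ((1 / 2 * ‖z - x 0‖ ^ 2 -
          χ / 2 * ∑ i ∈ Finset.Icc 1 (j - 1), A i * L i * ‖y i - xt (i - 1)‖ ^ 2 : ℝ) : EReal) := by
  intro z hz
  have key : ∀ k : ℕ, k ≤ j - 1 → σ k z ≤ ((1 / 2 * ‖z - x 0‖ ^ 2 -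
      χ / 2 * ∑ i ∈ Finset.Icc 1 k, A i * L i * ‖y i - xt (i - 1)‖ ^ 2 : ℝ) : EReal) := by
    intro k
    induction k with
    | zero => intro _; rw [hσ0]; simp
    | succ k ih =>
      intro hk
      have h1 := ih (by omega)
      have h2 := hdec (k + 1) (by omega) hk z hz
      rw [Finset.sum_Icc_succ_top (by omega)]
      simp only [Nat.add_sub_cancel] at h2 ⊢
      generalize σ k z = a at h1 h2
      generalize σ (k + 1) z = b at h2 ⊢
      induction b with
      | bot => exact bot_le
      | top =>
        rw [EReal.sub_top] at h2
        exact absurd (le_bot_iff.mp h2) (EReal.coe_ne_bot _)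
      | coe b =>
        induction a with
        | bot =>
          rw [EReal.bot_sub] at h2
          exact absurd (le_bot_iff.mp h2) (EReal.coe_ne_bot _)
        | top => exact absurd (top_le_iff.mp h1) (EReal.coe_ne_top _)
        | coe a =>
          norm_cast at h1 h2 ⊢
          linarith
  have h := key (j - 1) le_rfl
  rw [hσ (j - 1) (by omega) le_rfl] at h
  refine le_trans ?_ h
  have hA : (0 : EReal) ≤ (A (j - 1) : EReal) := by exact_mod_cast hAnonneg (j - 1) le_rfl
  exact add_le_add (mul_le_mul_of_nonneg_left (EReal.sub_le_sub hξ le_rfl) hA) le_rfl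
end
end

section
/- Let E be a real inner product space, ψ_s : E → ℝ differentiable convex, ψ_n : E → ℝ ∪ {∞} proper closed convex, ψ = ψ_s + ψ_n, δ > 0 and ε > 0. Let ϑ', ϑ, w ∈ E and u ∈ E satisfy: u ∈ ∇ψ_s(w) + δ(w − ϑ') + ∂ψ_n(w), and ψ(ϑ) + (δ/2)‖ϑ − ϑ'‖² ≤ ψ(w) + (δ/2)‖w − ϑ'‖². Then (δ/2)‖ϑ − w‖² ≤ ⟨u, w − ϑ⟩, hence δ‖w − ϑ‖ ≤ 2‖u‖ and ‖w‖ ≤ ‖ϑ‖ + (2/δ)‖u‖. In particular, if ‖ϑ‖ ≤ D and ‖u‖ ≤ ε/6, then ‖w‖ ≤ D + ε/(3δ). -/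
noncomputable section

open RealInnerProductSpace

variable {E : Type*} [NormedAddCommGroup E] [InnerProductSpace ℝ E]

/-- Lemma 3.4 of the A-REG analysis: if
`u ∈ ∇ψ_s(w) + δ(w − ϑ') + ∂ψ_n(w)` and `ψ_δ(ϑ; ϑ') ≤ ψ_δ(w; ϑ')`, then
`(δ/2)‖ϑ − w‖² ≤ ⟨u, w − ϑ⟩`, hence `δ‖w − ϑ‖ ≤ 2‖u‖` and `‖w‖ ≤ ‖ϑ‖ + (2/δ)‖u‖`;
in particular, `‖ϑ‖ ≤ D` and `‖u‖ ≤ ε/6` imply `‖w‖ ≤ D + ε/(3δ)`. -/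
theorem areg_iterate_bound
    (ψs : E → ℝ) (g : E → E) (hg : ∀ x : E, HasFDerivAt ψs ((innerSL ℝ) (g x)) x)
    (hψsconv : ConvexOn ℝ Set.univ ψs)
    (ψn : E → EReal) (hproper : ProperFun ψn) (hclosed : LowerSemicontinuous ψn)
    (hψnconv : ERealConvexOn ψn)
    (δ ε : ℝ) (hδ : 0 < δ) (hε : 0 < ε)
    (ϑ' ϑ w u : E)
    (hincl : u - g w - δ • (w - ϑ') ∈ epsSubdiff ψn 0 w)
    (hmin : ((ψs ϑ + δ / 2 * ‖ϑ - ϑ'‖ ^ 2 : ℝ) : EReal) + ψn ϑ ≤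
            ((ψs w + δ / 2 * ‖w - ϑ'‖ ^ 2 : ℝ) : EReal) + ψn w) :
    δ / 2 * ‖ϑ - w‖ ^ 2 ≤ ⟪u, w - ϑ⟫ ∧
    δ * ‖w - ϑ‖ ≤ 2 * ‖u‖ ∧
    ‖w‖ ≤ ‖ϑ‖ + 2 / δ * ‖u‖ ∧
    ∀ D : ℝ, ‖ϑ‖ ≤ D → ‖u‖ ≤ ε / 6 → ‖w‖ ≤ D + ε / (3 * δ) := by
  have hgrad : ψs w + ⟪g w, ϑ - w⟫ ≤ ψs ϑ := by
    have hl : ∀ t : ℝ, HasDerivAt (fun t : ℝ => w + t • (ϑ - w)) (ϑ - w) t := by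
      intro t
      simpa using ((hasDerivAt_id t).smul_const (ϑ - w)).const_add w
    have hd : HasDerivAt (fun t : ℝ => ψs (w + t • (ϑ - w))) (⟪g w, ϑ - w⟫) 0 := by
      have h1 := (hg (w + (0 : ℝ) • (ϑ - w))).comp_hasDerivAt (0 : ℝ) (hl 0)
      simpa [Function.comp_def] using h1
    have hc : ConvexOn ℝ Set.univ (fun t : ℝ => ψs (w + t • (ϑ - w))) := by
      refine ⟨convex_univ, ?_⟩
      intro x _ y _ a b ha hb hab
      have h2 := hψsconv.2 (Set.mem_univ (w + x • (ϑ - w))) (Set.mem_univ (w + y • (ϑ - w)))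
        ha hb hab
      have h3 : w + (a • x + b • y) • (ϑ - w)
          = a • (w + x • (ϑ - w)) + b • (w + y • (ϑ - w)) := by
        have hb' : b = 1 - a := by linarith
        subst hb'
        simp only [smul_eq_mul]
        module
      simpa only [h3] using h2
    have h4 := hc.le_slope_of_hasDerivAt (Set.mem_univ (0 : ℝ)) (Set.mem_univ (1 : ℝ))
      one_pos hd
    simp [slope_def_field] at h4
    linarith
  have hwtop : ψn w ≠ ⊤ := by
    intro h
    obtain ⟨z, hz⟩ := hproper.2
    have h1 := hincl z
    rw [h, EReal.top_add_coe] at h1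
    exact hz (top_le_iff.mp h1)
  have hwbot := hproper.1 w
  have htbot := hproper.1 ϑ
  have hsub := hincl ϑ
  obtain ⟨a, ha⟩ : ∃ a : ℝ, ψn w = a := ⟨_, (EReal.coe_toReal hwtop hwbot).symm⟩
  rw [ha] at hsub hmin
  have httop : ψn ϑ ≠ ⊤ := by
    intro h
    rw [h, EReal.coe_add_top, ← EReal.coe_add] at hmin
    exact EReal.coe_ne_top _ (top_le_iff.mp hmin)
  obtain ⟨b, hb⟩ : ∃ b : ℝ, ψn ϑ = b := ⟨_, (EReal.coe_toReal httop htbot).symm⟩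
  rw [hb] at hsub hmin
  rw [← EReal.coe_add, EReal.coe_le_coe_iff] at hsub
  rw [← EReal.coe_add, ← EReal.coe_add, EReal.coe_le_coe_iff] at hmin
  have hexp : ‖ϑ - ϑ'‖ ^ 2
      = ‖ϑ - w‖ ^ 2 + 2 * ⟪w - ϑ', ϑ - w⟫ + ‖w - ϑ'‖ ^ 2 := by
    have h : ϑ - ϑ' = (ϑ - w) + (w - ϑ') := by abel
    rw [h, norm_add_sq_real, real_inner_comm]
  rw [hexp] at hmin
  rw [inner_sub_left, inner_sub_left, real_inner_smul_left] at hsub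
  have hneg : ⟪u, w - ϑ⟫ = - ⟪u, ϑ - w⟫ := by
    rw [← inner_neg_right, neg_sub]
  have h1 : δ / 2 * ‖ϑ - w‖ ^ 2 ≤ ⟪u, w - ϑ⟫ := by
    rw [hneg]
    linarith
  have h2 : δ * ‖w - ϑ‖ ≤ 2 * ‖u‖ := by
    have hcs := real_inner_le_norm u (w - ϑ)
    rw [norm_sub_rev ϑ w] at h1
    rcases (norm_nonneg (w - ϑ)).eq_or_lt with h0 | h0
    · rw [← h0]
      simp
    · refine le_of_mul_le_mul_right ?_ h0
      nlinarith
  have h3 : ‖w‖ ≤ ‖ϑ‖ + 2 / δ * ‖u‖ := by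
    have h4 : ‖w - ϑ‖ ≤ 2 / δ * ‖u‖ := by
      rw [div_mul_eq_mul_div, le_div_iff₀ hδ]
      linarith
    have h5 := norm_sub_norm_le w ϑ
    linarith
  refine ⟨h1, h2, h3, ?_⟩
  intro D hD hu
  have h6 : 2 / δ * ‖u‖ ≤ 2 / δ * (ε / 6) := by gcongr
  have h7 : 2 / δ * (ε / 6) = ε / (3 * δ) := by
    field_simp
    norm_num
  linarith
end
end
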